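/- arXiv:2001.02546 — 3 statements merged into one kernel-verified Lean document; each statement's English description precedes it below -/
import Mathlib

section
/- Let α > 0 and H₀ ≥ e be real numbers and define f : ℝ → ℝ by f(x) = x·(log(x + H₀))^α (real power). Then for every x ≥ 0 the second derivative of f at x equals (α/(x + H₀))·(log(x + H₀))^(α−2)·( log(x + H₀) + H₀·log(x + H₀)/(x + H₀) + (α − 1)·x/(x + H₀) ), and this quantity is strictly positive; in particular f is strictly convex on [0, ∞). -/
theorem hasDerivAt_log_add_rpow {c x : ℝ} (hx : 1 < x + c) (p : ℝ) :
    HasDerivAt (fun y => Real.log (y + c) ^ p)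
      (p * Real.log (x + c) ^ (p - 1) / (x + c)) x := by
  have hlog := ((hasDerivAt_id' x).add_const c).log (by linarith)
  convert hlog.rpow_const (p := p) (Or.inl (Real.log_pos hx).ne') using 1
  ring

theorem hasDerivAt_mul_log_add_rpow {c x : ℝ} (hx : 1 < x + c) (p : ℝ) :
    HasDerivAt (fun y => y * Real.log (y + c) ^ p)
      (Real.log (x + c) ^ p + p * (x * Real.log (x + c) ^ (p - 1)) / (x + c)) x := by
  refine ((hasDerivAt_id' x).mul (hasDerivAt_log_add_rpow hx p)).congr_deriv ?_
  ring

theorem deriv_deriv_mul_log_add_rpow {c x : ℝ} (hx : 1 < x + c) (p : ℝ) :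
    deriv (deriv fun y => y * Real.log (y + c) ^ p) x =
      p / (x + c) * Real.log (x + c) ^ (p - 2) *
        (Real.log (x + c) + c * Real.log (x + c) / (x + c) + (p - 1) * x / (x + c)) := by
  have hderiv : (deriv fun y => y * Real.log (y + c) ^ p) =ᶠ[nhds x] fun y =>
      Real.log (y + c) ^ p + p * (y * Real.log (y + c) ^ (p - 1)) / (y + c) := by
    filter_upwards [lt_mem_nhds (show 1 - c < x by linarith)] with y hy
    exact (hasDerivAt_mul_log_add_rpow (by linarith) p).deriv
  have hne : x + c ≠ 0 := by linarith
  have hd := (hasDerivAt_log_add_rpow hx p).add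
    (((hasDerivAt_mul_log_add_rpow hx (p - 1)).const_mul p).div
      ((hasDerivAt_id' x).add_const c) hne)
  rw [hderiv.deriv_eq]
  refine hd.deriv.trans ?_
  have hpow : Real.log (x + c) ^ (p - 1) =
      Real.log (x + c) ^ (p - 2) * Real.log (x + c) := by
    rw [← Real.rpow_add_one (Real.log_pos hx).ne']
    ring_nf
  rw [show p - 1 - 1 = p - 2 by ring, hpow]
  field_simp
  ring

theorem stmt_2 (α H₀ : ℝ) (hα : 0 < α) (hH₀ : Real.exp 1 ≤ H₀)
    (f : ℝ → ℝ) (hf : f = fun x => x * Real.log (x + H₀) ^ α) :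
    (∀ x : ℝ, 0 ≤ x →
      deriv (deriv f) x =
        α / (x + H₀) * Real.log (x + H₀) ^ (α - 2) *
          (Real.log (x + H₀) + H₀ * Real.log (x + H₀) / (x + H₀) +
            (α - 1) * x / (x + H₀)) ∧
      0 < deriv (deriv f) x) ∧
    StrictConvexOn ℝ (Set.Ici 0) f := by
  subst hf
  have hH : 1 < H₀ := (Real.one_lt_exp_iff.2 one_pos).trans_le hH₀
  have key : ∀ x : ℝ, 0 ≤ x → 0 < deriv (deriv fun x => x * Real.log (x + H₀) ^ α) x := by
    intro x hx
    have hu : 0 < x + H₀ := by linarith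
    have hL : 1 ≤ Real.log (x + H₀) := (Real.le_log_iff_exp_le hu).2 (by linarith)
    have hL0 : 0 < Real.log (x + H₀) := by linarith
    rw [deriv_deriv_mul_log_add_rpow (by linarith)]
    have h1 : 0 < H₀ * Real.log (x + H₀) / (x + H₀) := by positivity
    have h2 : 0 ≤ α * x / (x + H₀) := by positivity
    have h3 : x / (x + H₀) ≤ 1 := (div_le_one hu).2 (by linarith)
    have h4 : (α - 1) * x / (x + H₀) = α * x / (x + H₀) - x / (x + H₀) := by ring
    exact mul_pos (by positivity) (by linarith)
  refine ⟨fun x hx => ⟨deriv_deriv_mul_log_add_rpow (by linarith) α, key x hx⟩, ?_⟩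
  refine strictConvexOn_of_deriv2_pos' (convex_Ici 0) (fun x hx => ?_) fun x hx => key x hx
  have hx' : 1 < x + H₀ := by linarith [Set.mem_Ici.1 hx]
  exact (hasDerivAt_mul_log_add_rpow hx' α).continuousAt.continuousWithinAt
end

section
/- Let n ≥ 1 be an integer. For every η with 0 < η < 1/n there exists a constant C with 0 < C < 1/n^n such that every λ : Fin n → ℝ with λ i > 0 for all i and (∏ i, λ i)/(∑ i, λ i)^n ≥ C satisfies λ k ≥ (1/n − η)·(∑ i, λ i) for every index k. -/
theorem mul_exp_one_sub_lt {s t : ℝ} (hs : 0 < s) (hs1 : s ≤ 1) (hts : t < s) :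
    t * Real.exp (1 - t) < s * Real.exp (1 - s) := by
  have h1 : t - s + 1 < Real.exp (t - s) := Real.add_one_lt_exp (by linarith)
  have h2 : t < s * Real.exp (t - s) := by nlinarith
  calc t * Real.exp (1 - t) < s * Real.exp (t - s) * Real.exp (1 - t) := by gcongr
    _ = s * Real.exp (1 - s) := by
      rw [mul_assoc, ← Real.exp_add]
      congr 2
      ring

theorem prod_le_mul_exp_one_sub {ι : Type*} [Fintype ι] {x : ι → ℝ} (hx : ∀ i, 0 ≤ x i)
    (hsum : ∑ i, (x i - 1) = 0) (k : ι) :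
    ∏ i, x i ≤ x k * Real.exp (1 - x k) := by
  classical
  have hrest : ∑ i ∈ Finset.univ.erase k, (x i - 1) = 1 - x k := by
    have := Finset.add_sum_erase Finset.univ (fun i => x i - 1) (Finset.mem_univ k)
    linarith
  rw [← Finset.mul_prod_erase Finset.univ x (Finset.mem_univ k), ← hrest, Real.exp_sum]
  refine mul_le_mul_of_nonneg_left (Finset.prod_le_prod (fun i _ => hx i) fun i _ => ?_) (hx k)
  linarith [Real.add_one_le_exp (x i - 1)]

theorem stmt_8 (n : ℕ) (hn : 1 ≤ n) :
    ∀ η : ℝ, 0 < η → η < 1 / n →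
      ∃ C : ℝ, 0 < C ∧ C < 1 / (n : ℝ) ^ n ∧
        ∀ l : Fin n → ℝ, (∀ i, 0 < l i) →
          C ≤ (∏ i, l i) / (∑ i, l i) ^ n →
          ∀ k, (1 / n - η) * ∑ i, l i ≤ l k := by
  intro η hη hηn
  have hn0 : (0 : ℝ) < n := by exact_mod_cast hn
  set s : ℝ := 1 - n * η with hs
  have hs0 : 0 < s := by
    rw [lt_div_iff₀ hn0] at hηn
    linarith
  have hs1 : s < 1 := by
    have := mul_pos hn0 hη
    linarith
  refine ⟨s * Real.exp (1 - s) / (n : ℝ) ^ n, by positivity, ?_, fun l hl hC k => ?_⟩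
  · have := mul_exp_one_sub_lt one_pos le_rfl hs1
    rw [sub_self, Real.exp_zero, mul_one] at this
    gcongr
  · have hH : 0 < ∑ i, l i := Finset.sum_pos (fun i _ => hl i) ⟨k, Finset.mem_univ k⟩
    set H := ∑ i, l i with hHdef
    by_contra! hlt
    have hsum : ∑ i, (n * l i / H - 1) = 0 := by
      rw [Finset.sum_sub_distrib, ← Finset.sum_div, ← Finset.mul_sum, ← hHdef]
      simp [hH.ne']
    have hprod : ∏ i, (n * l i / H) = (n : ℝ) ^ n * ((∏ i, l i) / H ^ n) := by
      rw [Finset.prod_div_distrib, Finset.prod_mul_distrib]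
      simp [mul_div_assoc]
    have hle := prod_le_mul_exp_one_sub
      (fun i => div_nonneg (mul_nonneg hn0.le (hl i).le) hH.le) hsum k
    have hk : n * l k / H < s := by
      rw [div_lt_iff₀ hH]
      calc n * l k < n * ((1 / n - η) * H) := by gcongr
        _ = s * H := by
          rw [hs]
          field_simp
    rw [div_le_iff₀' (by positivity), ← hprod] at hC
    exact (hC.trans hle).not_gt (mul_exp_one_sub_lt hs0 hs1.le hk)
end

section
/- Let n ≥ 1 be an integer and ε > 0. There exists δ > 0 such that for every λ : Fin n → ℝ with (∑ i, λ i) > 0 and λ i ≥ ε·(∑ j, λ j) for all i, one has ( n·(∑ i, (λ i)²) − (∑ i, λ i)² ) / (∑ i, λ i)² ≥ δ·( 1/n^n − (∏ i, λ i)/(∑ i, λ i)^n ). -/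
open Finset in
/-- If finitely many reals have mean `1` and are bounded below by `c > 0`, the defect of their
product from `1` is controlled by their squared deviation from `1`. -/
theorem mul_one_sub_prod_le_sum_sq_sub_one {ι : Type*} (s : Finset ι) {x : ι → ℝ} {c : ℝ}
    (hc : 0 < c) (hx : ∀ i ∈ s, c ≤ x i) (hsum : ∑ i ∈ s, (x i - 1) = 0) :
    c * (1 - ∏ i ∈ s, x i) ≤ ∑ i ∈ s, (x i - 1) ^ 2 := by
  have hpos : ∀ i ∈ s, 0 < x i := fun i hi => hc.trans_le (hx i hi)
  have hprod : 1 + ∑ i ∈ s, (1 - (x i)⁻¹) ≤ ∏ i ∈ s, x i := by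
    calc 1 + ∑ i ∈ s, (1 - (x i)⁻¹) ≤ Real.exp (∑ i ∈ s, (1 - (x i)⁻¹)) := by
          linarith [Real.add_one_le_exp (∑ i ∈ s, (1 - (x i)⁻¹))]
      _ = ∏ i ∈ s, Real.exp (1 - (x i)⁻¹) := Real.exp_sum _ _
      _ ≤ ∏ i ∈ s, x i := prod_le_prod (fun i _ => (Real.exp_pos _).le) fun i hi =>
          (Real.le_log_iff_exp_le (hpos i hi)).1 (Real.one_sub_inv_le_log_of_pos (hpos i hi))
  have hterm : ∀ i ∈ s, c * ((x i - 1) - (1 - (x i)⁻¹)) ≤ (x i - 1) ^ 2 := fun i hi => by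
    have h0 := hpos i hi
    have heq : (x i - 1) - (1 - (x i)⁻¹) = (x i - 1) ^ 2 / x i := by field_simp
    rw [heq, ← mul_div_assoc, div_le_iff₀ h0, mul_comm c]
    exact mul_le_mul_of_nonneg_left (hx i hi) (sq_nonneg _)
  calc c * (1 - ∏ i ∈ s, x i) ≤ c * (∑ i ∈ s, (x i - 1) - ∑ i ∈ s, (1 - (x i)⁻¹)) :=
        mul_le_mul_of_nonneg_left (by linarith) hc.le
    _ = ∑ i ∈ s, c * ((x i - 1) - (1 - (x i)⁻¹)) := by rw [← sum_sub_distrib, mul_sum]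
    _ ≤ _ := sum_le_sum hterm

theorem stmt_12 (n : ℕ) (hn : 1 ≤ n) (ε : ℝ) (hε : 0 < ε) :
    ∃ δ : ℝ, 0 < δ ∧
      ∀ l : Fin n → ℝ, 0 < (∑ i, l i) →
        (∀ i, ε * ∑ j, l j ≤ l i) →
        δ * (1 / (n : ℝ) ^ n - (∏ i, l i) / (∑ i, l i) ^ n) ≤
          (n * (∑ i, (l i) ^ 2) - (∑ i, l i) ^ 2) / (∑ i, l i) ^ 2 := by
  have hn0 : (0 : ℝ) < n := by exact_mod_cast hn
  refine ⟨ε * n ^ n, by positivity, fun l hH hl => ?_⟩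
  set H := ∑ i, l i with hHdef
  have key := mul_one_sub_prod_le_sum_sq_sub_one Finset.univ (x := fun i => n / H * l i)
    (c := n * ε) (by positivity)
    (fun i _ => by
      rw [div_mul_eq_mul_div, le_div_iff₀ hH, mul_assoc]
      exact mul_le_mul_of_nonneg_left (hl i) hn0.le)
    (by
      rw [Finset.sum_sub_distrib, ← Finset.mul_sum, ← hHdef]
      simp [hH.ne'])
  have hprod : ∏ i, (n / H * l i) = n ^ n * ((∏ i, l i) / H ^ n) := by
    rw [Finset.prod_mul_distrib, Finset.prod_const, Finset.card_univ, Fintype.card_fin, div_pow]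
    ring
  have hsq : ∑ i, (n / H * l i - 1) ^ 2 = n * ((n * (∑ i, (l i) ^ 2) - H ^ 2) / H ^ 2) := by
    have hexp : ∀ i, (n / H * l i - 1) ^ 2 = (n / H) ^ 2 * l i ^ 2 - 2 * (n / H) * l i + 1 :=
      fun i => by ring
    simp only [hexp, Finset.sum_add_distrib, Finset.sum_sub_distrib, ← Finset.mul_sum, ← hHdef]
    simp only [Finset.sum_const, Finset.card_univ, Fintype.card_fin, nsmul_eq_mul]
    field_simp
    ring
  rw [hprod, hsq, mul_assoc] at key
  have hfactor : ε * n ^ n * (1 / (n : ℝ) ^ n - (∏ i, l i) / H ^ n)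
      = ε * (1 - n ^ n * ((∏ i, l i) / H ^ n)) := by
    field_simp
  rw [hfactor]
  exact le_of_mul_le_mul_left key hn0
end
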